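/- arXiv:1602.06577 — 4 statements merged into one kernel-verified Lean document; each statement's English description precedes it below -/
import Mathlib

section
/- For every w > 0 and every ρ with −1 < ρ < 1, the function ρ ↦ P₃₃(ρ,w) is differentiable at ρ with derivative (1/(2π)) · (1/√(1−ρ²)) · exp(−w²/(1+ρ)). -/
open MeasureTheory Real

/-- Standard bivariate normal density with correlation `ρ`. -/
noncomputable def f (ρ x y : ℝ) : ℝ :=
  (1 / (2 * Real.pi * Real.sqrt (1 - ρ ^ 2))) *
    Real.exp (-(x ^ 2 - 2 * ρ * x * y + y ^ 2) / (2 * (1 - ρ ^ 2)))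

noncomputable def P33 (ρ w : ℝ) : ℝ := ∫ x in Set.Ioi w, ∫ y in Set.Ioi w, f ρ x y

noncomputable def EE (t : ℝ) : ℝ := Real.exp (-(1/2) * t ^ 2)

noncomputable def TT (t : ℝ) : ℝ := ∫ u in Set.Ioi t, EE u

lemma EE_pos (t : ℝ) : 0 < EE t := Real.exp_pos _

lemma EE_le_one (t : ℝ) : EE t ≤ 1 := by
  unfold EE
  rw [Real.exp_le_one_iff]
  nlinarith [sq_nonneg t]

lemma EE_int : Integrable EE := integrable_exp_neg_mul_sq (by norm_num)

lemma EE_hasDeriv (t : ℝ) : HasDerivAt EE (-t * EE t) t := by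
  unfold EE
  have h := ((hasDerivAt_pow 2 t).const_mul (-(1/2) : ℝ)).exp
  convert h using 1
  push_cast
  ring

lemma EE_cont : Continuous EE := by
  unfold EE
  fun_prop

lemma TT_hasDeriv (t : ℝ) : HasDerivAt TT (-EE t) t := by
  have h : TT = fun t => TT 0 - ∫ u in (0:ℝ)..t, EE u := by
    funext t
    have := intervalIntegral.integral_interval_add_Ioi (a := 0) (b := t) (f := EE) (μ := volume)
      EE_int.integrableOn EE_int.integrableOn
    unfold TT
    linarith
  rw [h]
  exact (intervalIntegral.integral_hasDerivAt_right (EE_cont.intervalIntegrable _ _)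
    EE_cont.aestronglyMeasurable.stronglyMeasurableAtFilter EE_cont.continuousAt).const_sub _

lemma TT_cont : Continuous TT :=
  continuous_iff_continuousAt.2 fun t => (TT_hasDeriv t).continuousAt

lemma TT_bound (t : ℝ) : |TT t| ≤ ∫ u, EE u := by
  unfold TT
  rw [abs_of_nonneg (integral_nonneg fun u => (EE_pos u).le)]
  exact setIntegral_le_integral EE_int (Filter.Eventually.of_forall fun u => (EE_pos u).le)

lemma shift_Ioi (g : ℝ → ℝ) (a c : ℝ) :
    ∫ y in Set.Ioi a, g (y - c) = ∫ u in Set.Ioi (a - c), g u := by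
  rw [← integral_indicator measurableSet_Ioi, ← integral_indicator measurableSet_Ioi,
    ← integral_sub_right_eq_self (Set.indicator (Set.Ioi (a - c)) _) c]
  congr 1
  ext y
  simp [Set.indicator, Set.mem_Ioi]

lemma inner_eq (r w x : ℝ) (hr : 0 < 1 - r ^ 2) :
    ∫ y in Set.Ioi w, f r x y
      = 1 / (2 * Real.pi) * EE x * TT ((w - r * x) / √(1 - r ^ 2)) := by
  have hs : 0 < √(1 - r ^ 2) := Real.sqrt_pos.2 hr
  have hsq : √(1 - r ^ 2) ^ 2 = 1 - r ^ 2 := Real.sq_sqrt hr.le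
  have h1 : ∀ y, f r x y = 1 / (2 * Real.pi * √(1 - r ^ 2)) * EE x *
      EE ((√(1 - r ^ 2))⁻¹ * (y - r * x)) := by
    intro y
    unfold f EE
    rw [mul_assoc _ (Real.exp _), ← Real.exp_add]
    congr 2
    rw [mul_pow, inv_pow, hsq]
    field_simp
    ring
  simp_rw [h1]
  rw [integral_const_mul, shift_Ioi (fun z => EE ((√(1 - r ^ 2))⁻¹ * z)),
    integral_comp_mul_left_Ioi _ _ (inv_pos.2 hs)]
  unfold TT
  rw [div_eq_inv_mul (w - r * x)]
  simp only [inv_inv, smul_eq_mul]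
  field_simp

noncomputable def DD (w r x : ℝ) : ℝ :=
  1 / (2 * Real.pi) * EE x * (EE ((w - r * x) / √(1 - r ^ 2)) * (x - r * w) / √(1 - r ^ 2) ^ 3)

lemma F_hasDeriv (w r x : ℝ) (hr : 0 < 1 - r ^ 2) :
    HasDerivAt (fun r => 1 / (2 * Real.pi) * EE x * TT ((w - r * x) / √(1 - r ^ 2)))
      (DD w r x) r := by
  have hs : 0 < √(1 - r ^ 2) := Real.sqrt_pos.2 hr
  have hsq : √(1 - r ^ 2) ^ 2 = 1 - r ^ 2 := Real.sq_sqrt hr.le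
  have hS : HasDerivAt (fun r : ℝ => √(1 - r ^ 2)) (-r / √(1 - r ^ 2)) r := by
    have := ((hasDerivAt_pow 2 r).const_sub 1).sqrt hr.ne'
    convert this using 1
    push_cast
    field_simp
  have hN : HasDerivAt (fun r : ℝ => w - r * x) (-x) r := by
    simpa using ((hasDerivAt_id r).mul_const x).const_sub w
  have hq := hN.div hS hs.ne'
  have := ((TT_hasDeriv ((w - r * x) / √(1 - r ^ 2))).comp r hq).const_mul
    (1 / (2 * Real.pi) * EE x)
  refine this.congr_deriv ?_
  unfold DD
  congr 1
  generalize EE ((w - r * x) / √(1 - r ^ 2)) = e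
  generalize √(1 - r ^ 2) = s at hs hsq
  field_simp
  have : s ^ 2 = 1 - r ^ 2 := hsq
  linear_combination e * x * this

lemma A_hasDeriv (w r x : ℝ) (hr : 0 < 1 - r ^ 2) :
    HasDerivAt (fun x => -(1 / (2 * Real.pi) * (1 / √(1 - r ^ 2))) *
      (EE x * EE ((w - r * x) / √(1 - r ^ 2)))) (DD w r x) x := by
  have hs : 0 < √(1 - r ^ 2) := Real.sqrt_pos.2 hr
  have hsq : √(1 - r ^ 2) ^ 2 = 1 - r ^ 2 := Real.sq_sqrt hr.le
  have hN : HasDerivAt (fun x : ℝ => (w - r * x) / √(1 - r ^ 2)) (-r / √(1 - r ^ 2)) x := by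
    simpa using (((hasDerivAt_id x).const_mul r).const_sub w).div_const (√(1 - r ^ 2))
  have := ((EE_hasDeriv x).mul ((EE_hasDeriv ((w - r * x) / √(1 - r ^ 2))).comp x hN)).const_mul
    (-(1 / (2 * Real.pi) * (1 / √(1 - r ^ 2))))
  refine this.congr_deriv ?_
  unfold DD
  simp only [Function.comp]
  generalize EE ((w - r * x) / √(1 - r ^ 2)) = e
  generalize EE x = e'
  generalize √(1 - r ^ 2) = s at hs hsq
  field_simp
  linear_combination e' * e * x * hsq

lemma A_tendsto (w r : ℝ) :
    Filter.Tendsto (fun x => -(1 / (2 * Real.pi) * (1 / √(1 - r ^ 2))) *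
      (EE x * EE ((w - r * x) / √(1 - r ^ 2)))) Filter.atTop (nhds 0) := by
  have hE : Filter.Tendsto EE Filter.atTop (nhds 0) := by
    unfold EE
    refine Real.tendsto_exp_atBot.comp ?_
    exact (Filter.tendsto_pow_atTop two_ne_zero).const_mul_atTop_of_neg (by norm_num)
  have h : Filter.Tendsto (fun x => EE x * EE ((w - r * x) / √(1 - r ^ 2)))
      Filter.atTop (nhds 0) := by
    refine squeeze_zero (fun x => (mul_pos (EE_pos _) (EE_pos _)).le) (fun x => ?_) hE
    exact mul_le_of_le_one_right (EE_pos _).le (EE_le_one _)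
  simpa using h.const_mul (-(1 / (2 * Real.pi) * (1 / √(1 - r ^ 2))))

theorem stmt9 (w : ℝ) (hw : 0 < w) (ρ : ℝ) (h1 : -1 < ρ) (h2 : ρ < 1) :
    HasDerivAt (fun r => P33 r w)
      ((1 / (2 * Real.pi)) * (1 / Real.sqrt (1 - ρ ^ 2)) * Real.exp (-w ^ 2 / (1 + ρ))) ρ := by
  obtain ⟨a, ha1, ha2⟩ := exists_between (abs_lt.2 ⟨h1, h2⟩)
  have ha0 : 0 < a := (abs_nonneg ρ).trans_lt ha1
  have hc : 0 < 1 - a ^ 2 := by nlinarith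
  have hmem : Set.Ioo (-a) a ∈ nhds ρ := Ioo_mem_nhds (abs_lt.1 ha1).1 (abs_lt.1 ha1).2
  have hle : ∀ r ∈ Set.Ioo (-a) a, 1 - a ^ 2 ≤ 1 - r ^ 2 := by
    intro r hr
    nlinarith [hr.1, hr.2]
  have hpos : ∀ r ∈ Set.Ioo (-a) a, 0 < 1 - r ^ 2 := fun r hr => hc.trans_le (hle r hr)
  have hρ : 0 < 1 - ρ ^ 2 := by nlinarith
  set F : ℝ → ℝ → ℝ := fun r x => 1 / (2 * Real.pi) * EE x * TT ((w - r * x) / √(1 - r ^ 2))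
    with hF
  have hEEc := EE_cont
  have hTTc := TT_cont
  have hFc : ∀ r, Continuous (F r) := by
    intro r
    simp only [hF, div_eq_mul_inv]
    fun_prop
  have hDc : ∀ r, Continuous (DD w r) := by
    intro r
    unfold DD
    simp only [div_eq_mul_inv]
    fun_prop
  have hxE : Integrable (fun x => x * EE x) := integrable_mul_exp_neg_mul_sq (by norm_num)
  have key := hasDerivAt_integral_of_dominated_loc_of_deriv_le (μ := volume.restrict (Set.Ioi w))
    (F := F) (F' := DD w) (x₀ := ρ) (s := Set.Ioo (-a) a)
    (bound := fun x => 1 / (2 * Real.pi) / √(1 - a ^ 2) ^ 3 * (‖x * EE x‖ + w * EE x)) hmem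
    (Filter.Eventually.of_forall fun r => (hFc r).aestronglyMeasurable)
    (by
      refine Integrable.integrableOn ?_
      refine (EE_int.const_mul (1 / (2 * Real.pi) * ∫ u, EE u)).mono'
        (hFc ρ).aestronglyMeasurable (Filter.Eventually.of_forall fun x => ?_)
      simp only [hF, norm_mul, Real.norm_eq_abs, abs_of_pos (EE_pos x),
        abs_of_pos (show 0 < 1 / (2 * Real.pi) by positivity)]
      have := TT_bound ((w - ρ * x) / √(1 - ρ ^ 2))
      have hp : 0 ≤ 1 / (2 * Real.pi) * EE x := by have := EE_pos x; positivity
      nlinarith [mul_le_mul_of_nonneg_left this hp])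
    (hDc ρ).aestronglyMeasurable
    (by
      refine Filter.Eventually.of_forall fun x r hr => ?_
      have hs : 0 < √(1 - a ^ 2) := Real.sqrt_pos.2 hc
      have hsr : √(1 - a ^ 2) ≤ √(1 - r ^ 2) := Real.sqrt_le_sqrt (hle r hr)
      have hsr' := hs.trans_le hsr
      have hx := EE_pos x
      have hz := EE_pos ((w - r * x) / √(1 - r ^ 2))
      have hz1 := EE_le_one ((w - r * x) / √(1 - r ^ 2))
      have hxr : |x - r * w| ≤ |x| + w := by
        refine (abs_sub _ _).trans ?_
        rw [abs_mul, abs_of_pos hw]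
        have : |r| ≤ 1 := (abs_lt.2 ⟨hr.1, hr.2⟩).le.trans ha2.le
        nlinarith
      unfold DD
      simp only [norm_mul, norm_div, norm_pow, Real.norm_eq_abs, abs_of_pos hx, abs_of_pos hz,
        abs_of_pos hsr', abs_of_pos Real.pi_pos, abs_one, abs_two]
      calc 1 / (2 * Real.pi) * EE x * (EE ((w - r * x) / √(1 - r ^ 2)) * |x - r * w| /
              √(1 - r ^ 2) ^ 3)
          ≤ 1 / (2 * Real.pi) * EE x * (1 * (|x| + w) / √(1 - a ^ 2) ^ 3) := by
            gcongr
        _ = _ := by ring)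
    (by
      refine Integrable.integrableOn ?_
      exact (hxE.norm.add (EE_int.const_mul w)).const_mul _)
    (Filter.Eventually.of_forall fun x r hr => F_hasDeriv w r x (hpos r hr))
  obtain ⟨hint, hder⟩ := key
  have hval := integral_Ioi_of_hasDerivAt_of_tendsto' (a := w)
    (fun x _ => A_hasDeriv w ρ x hρ) hint (A_tendsto w ρ)
  rw [hval] at hder
  have heq : (fun r => P33 r w) =ᶠ[nhds ρ] fun r => ∫ x in Set.Ioi w, F r x := by
    filter_upwards [hmem] with r hr
    unfold P33
    congr 1
    ext x
    exact inner_eq r w x (hpos r hr)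
  refine (hder.congr_of_eventuallyEq heq).congr_deriv ?_
  have : EE w * EE ((w - ρ * w) / √(1 - ρ ^ 2)) = Real.exp (-w ^ 2 / (1 + ρ)) := by
    unfold EE
    rw [← Real.exp_add, div_pow, Real.sq_sqrt hρ.le]
    congr 1
    have e1 : 1 + ρ ≠ 0 := by linarith
    have e2 : 1 - ρ ≠ 0 := by linarith
    rw [show 1 - ρ ^ 2 = (1 + ρ) * (1 - ρ) by ring]
    field_simp
    ring
  rw [this]
  ring
end

section
/- For every w > 0 and every ρ with −1 < ρ < 1, the function ρ ↦ P₂₂(ρ,w) is twice differentiable at ρ, and its second derivative equals (1/(2π))·ρ/(1−ρ²)^{3/2} − (1/(2π))·(2ρ/(1−ρ²)^{3/2})·exp(−w²/(2(1−ρ²)))·[1 − w²/(1−ρ²)] + (1/(2π))·(1/√(1−ρ²))·exp(−w²/(1+ρ))·[ρ/(1−ρ²) + w²/(1+ρ)²]. -/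
open MeasureTheory Real

/-- Standard normal density. -/
noncomputable def stdPhi (x : ℝ) : ℝ := (1 / Real.sqrt (2 * Real.pi)) * Real.exp (-x ^ 2 / 2)

/-- Standard normal distribution function. -/
noncomputable def stdCdf (x : ℝ) : ℝ := ∫ t in Set.Iic x, stdPhi t

noncomputable def P22 (ρ w : ℝ) : ℝ := ∫ x in (0:ℝ)..w, ∫ y in (0:ℝ)..w, f ρ x y

lemma aux_param (F F' : ℝ → ℝ → ℝ) (w : ℝ) (r : ℝ) (h1 : -1 < r) (h2 : r < 1)
    (hF : ∀ ρ ∈ Set.Ioo (-1:ℝ) 1, Continuous (F ρ))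
    (hF' : ContinuousOn (fun p : ℝ × ℝ => F' p.1 p.2) (Set.Ioo (-1:ℝ) 1 ×ˢ Set.univ))
    (hd : ∀ ρ ∈ Set.Ioo (-1:ℝ) 1, ∀ t, HasDerivAt (fun ρ => F ρ t) (F' ρ t) ρ) :
    HasDerivAt (fun ρ => ∫ t in (0:ℝ)..w, F ρ t) (∫ t in (0:ℝ)..w, F' r t) r := by
  have hsub : Set.Icc ((r-1)/2) ((r+1)/2) ⊆ Set.Ioo (-1:ℝ) 1 := by
    intro x hx
    constructor <;> [linarith [hx.1]; linarith [hx.2]]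
  have hK : IsCompact (Set.Icc ((r-1)/2) ((r+1)/2) ×ˢ Set.uIcc 0 w) :=
    isCompact_Icc.prod isCompact_uIcc
  obtain ⟨C, hC⟩ := hK.exists_bound_of_continuousOn
    (hF'.mono (Set.prod_mono hsub (Set.subset_univ _)))
  have hr : r ∈ Set.Ioo (-1:ℝ) 1 := ⟨h1, h2⟩
  have hcr : Continuous (F' r) := by
    rw [← continuousOn_univ]
    exact hF'.comp (f := fun t : ℝ => (r, t)) (by fun_prop) (fun t _ => ⟨hr, trivial⟩)
  refine (intervalIntegral.hasDerivAt_integral_of_dominated_loc_of_deriv_le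
    (bound := fun _ => C) (s := Set.Icc ((r-1)/2) ((r+1)/2)) (F := F) (F' := F')
    (Icc_mem_nhds (by linarith) (by linarith)) ?_ ?_ ?_ ?_ ?_ ?_).2
  · filter_upwards [Ioo_mem_nhds h1 h2] with x hx
    exact (hF x hx).aestronglyMeasurable
  · exact (hF r hr).intervalIntegrable _ _
  · exact hcr.aestronglyMeasurable
  · exact Filter.Eventually.of_forall fun t ht x hx =>
      hC (x, t) ⟨hx, Set.uIoc_subset_uIcc ht⟩
  · exact intervalIntegrable_const
  · exact Filter.Eventually.of_forall fun t ht x hx => hd x (hsub hx) t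

lemma aux_s {r : ℝ} (hr : r ∈ Set.Ioo (-1:ℝ) 1) : 0 < 1 - r ^ 2 := by
  nlinarith [hr.1, hr.2]

lemma f_comm (r x y : ℝ) : f r x y = f r y x := by
  unfold f; ring_nf

lemma f_cont (r : ℝ) : Continuous (fun p : ℝ × ℝ => f r p.1 p.2) := by
  unfold f
  fun_prop

lemma f_contOn : ContinuousOn (fun p : ℝ × ℝ × ℝ => f p.1 p.2.1 p.2.2)
    (Set.Ioo (-1:ℝ) 1 ×ˢ Set.univ) := by
  unfold f
  have h : ∀ p ∈ (Set.Ioo (-1:ℝ) 1 ×ˢ (Set.univ : Set (ℝ × ℝ))), 0 < 1 - p.1 ^ 2 :=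
    fun p hp => aux_s hp.1
  refine ContinuousOn.mul (ContinuousOn.div (by fun_prop) (by fun_prop) ?_)
    (Real.continuous_exp.comp_continuousOn (ContinuousOn.div (by fun_prop) (by fun_prop) ?_))
  · intro p hp
    have := Real.sqrt_pos.2 (h p hp)
    positivity
  · intro p hp
    have := h p hp
    positivity

/-- the x-derivative -/
noncomputable def fx (r x y : ℝ) : ℝ := f r x y * (-(x - r * y) / (1 - r ^ 2))

noncomputable def fr (r x y : ℝ) : ℝ :=
  f r x y * ((x - r * y) * (y - r * x) / (1 - r ^ 2) ^ 2 + r / (1 - r ^ 2))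

lemma fx_contOn : ContinuousOn (fun p : ℝ × ℝ × ℝ => fx p.1 p.2.1 p.2.2)
    (Set.Ioo (-1:ℝ) 1 ×ˢ Set.univ) := by
  unfold fx
  refine f_contOn.mul (ContinuousOn.div (by fun_prop) (by fun_prop) ?_)
  intro p hp
  exact (aux_s hp.1).ne'

lemma fr_contOn : ContinuousOn (fun p : ℝ × ℝ × ℝ => fr p.1 p.2.1 p.2.2)
    (Set.Ioo (-1:ℝ) 1 ×ˢ Set.univ) := by
  unfold fr
  refine f_contOn.mul (ContinuousOn.add (ContinuousOn.div (by fun_prop) (by fun_prop) ?_)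
    (ContinuousOn.div (by fun_prop) (by fun_prop) ?_))
  · intro p hp
    exact (pow_pos (aux_s hp.1) 2).ne'
  · intro p hp
    exact (aux_s hp.1).ne'

lemma f_hasDeriv_x (r x y : ℝ) (hr : r ∈ Set.Ioo (-1:ℝ) 1) :
    HasDerivAt (fun x => f r x y) (fx r x y) x := by
  have hs := aux_s hr
  unfold fx f
  have h : HasDerivAt (fun x : ℝ => -(x ^ 2 - 2 * r * x * y + y ^ 2) / (2 * (1 - r ^ 2)))
      (-(x - r * y) / (1 - r ^ 2)) x := by
    have := ((((hasDerivAt_id x).pow 2).sub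
      (((hasDerivAt_id x).const_mul (2 * r)).mul_const y)).add_const (y ^ 2)).neg.div_const
      (2 * (1 - r ^ 2))
    refine this.congr_deriv ?_
    simp
    field_simp
  refine (h.exp.const_mul _).congr_deriv ?_
  ring

lemma fx_hasDeriv_y (r x y : ℝ) (hr : r ∈ Set.Ioo (-1:ℝ) 1) :
    HasDerivAt (fun y => fx r x y) (fr r x y) y := by
  have hs := aux_s hr
  have h1 : HasDerivAt (fun y => f r x y) (fx r y x) y := by
    have := f_hasDeriv_x r y x hr
    simpa only [f_comm r x] using this
  have h2 : HasDerivAt (fun y => -(x - r * y) / (1 - r ^ 2)) (r / (1 - r ^ 2)) y := by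
    have := (((hasDerivAt_id y).const_mul r).const_sub x).neg.div_const (1 - r ^ 2)
    refine this.congr_deriv ?_
    simp
  refine (h1.mul h2).congr_deriv ?_
  unfold fx fr
  rw [f_comm r y x]
  field_simp

lemma f_hasDeriv_r (r x y : ℝ) (hr : r ∈ Set.Ioo (-1:ℝ) 1) :
    HasDerivAt (fun r => f r x y) (fr r x y) r := by
  have hs := aux_s hr
  have hq := Real.sqrt_pos.2 hs
  have hq2 := Real.sq_sqrt hs.le
  unfold fr f
  have hs1 : HasDerivAt (fun r : ℝ => 1 - r ^ 2) (-(2 * r)) r := by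
    refine (((hasDerivAt_id r).pow 2).const_sub 1).congr_deriv ?_
    simp
  have h1 : HasDerivAt (fun r : ℝ => 1 / (2 * Real.pi * Real.sqrt (1 - r ^ 2)))
      (1 / (2 * Real.pi * Real.sqrt (1 - r ^ 2)) * (r / (1 - r ^ 2))) r := by
    have := (hasDerivAt_const r (1:ℝ)).div ((hs1.sqrt hs.ne').const_mul (2 * Real.pi))
      (by positivity)
    refine this.congr_deriv ?_
    rw [show r / (1 - r ^ 2) = r / Real.sqrt (1 - r ^ 2) ^ 2 by rw [hq2]]
    field_simp
    ring
  have h2 : HasDerivAt (fun r : ℝ => -(x ^ 2 - 2 * r * x * y + y ^ 2) / (2 * (1 - r ^ 2)))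
      ((x - r * y) * (y - r * x) / (1 - r ^ 2) ^ 2) r := by
    have hn : HasDerivAt (fun r : ℝ => -(x ^ 2 - 2 * r * x * y + y ^ 2)) (2 * x * y) r := by
      have := ((((((hasDerivAt_id r).const_mul 2).mul_const x).mul_const y).const_sub
        (x ^ 2)).add_const (y ^ 2)).neg
      refine this.congr_deriv ?_
      simp
    refine (hn.div (hs1.const_mul 2) (by positivity)).congr_deriv ?_
    field_simp
    ring
  refine (h1.mul h2.exp).congr_deriv ?_
  ring

lemma fr_cont (r x : ℝ) : Continuous (fun y => fr r x y) := by
  unfold fr f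
  fun_prop

lemma fx_cont (r y : ℝ) : Continuous (fun x => fx r x y) := by
  unfold fx f
  fun_prop

lemma P_hasDeriv (r w : ℝ) (hr : r ∈ Set.Ioo (-1:ℝ) 1) :
    HasDerivAt (fun r => P22 r w) (f r w w - f r 0 w - f r w 0 + f r 0 0) r := by
  have inner : ∀ ρ ∈ Set.Ioo (-1:ℝ) 1, ∀ x, HasDerivAt (fun ρ => ∫ y in (0:ℝ)..w, f ρ x y)
      (fx ρ x w - fx ρ x 0) ρ := by
    intro ρ hρ x
    have := aux_param (fun ρ y => f ρ x y) (fun ρ y => fr ρ x y) w ρ hρ.1 hρ.2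
      (fun ρ _ => (f_cont ρ).comp (by fun_prop : Continuous fun y : ℝ => (x, y)))
      (fr_contOn.comp (f := fun p : ℝ × ℝ => (p.1, x, p.2)) (by fun_prop)
        (fun p hp => ⟨hp.1, trivial⟩))
      (fun ρ hρ t => f_hasDeriv_r ρ x t hρ)
    rwa [intervalIntegral.integral_eq_sub_of_hasDerivAt
      (fun y _ => fx_hasDeriv_y ρ x y hρ) ((fr_cont ρ x).intervalIntegrable _ _)] at this
  have outer := aux_param (fun ρ x => ∫ y in (0:ℝ)..w, f ρ x y)
    (fun ρ x => fx ρ x w - fx ρ x 0) w r hr.1 hr.2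
    (fun ρ _ => intervalIntegral.continuous_parametric_intervalIntegral_of_continuous'
      (f_cont ρ) _ _)
    ((fx_contOn.comp (f := fun p : ℝ × ℝ => (p.1, p.2, w)) (by fun_prop)
        (fun p hp => ⟨hp.1, trivial⟩)).sub
      (fx_contOn.comp (f := fun p : ℝ × ℝ => (p.1, p.2, (0:ℝ))) (by fun_prop)
        (fun p hp => ⟨hp.1, trivial⟩)))
    inner
  rw [intervalIntegral.integral_sub ((fx_cont r w).intervalIntegrable _ _)
    ((fx_cont r 0).intervalIntegrable _ _),
    intervalIntegral.integral_eq_sub_of_hasDerivAt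
      (fun x _ => f_hasDeriv_x r x w hr) ((fx_cont r w).intervalIntegrable _ _),
    intervalIntegral.integral_eq_sub_of_hasDerivAt
      (fun x _ => f_hasDeriv_x r x 0 hr) ((fx_cont r 0).intervalIntegrable _ _)] at outer
  refine outer.congr_deriv ?_
  ring

theorem stmt10 (w : ℝ) (hw : 0 < w) (ρ : ℝ) (h1 : -1 < ρ) (h2 : ρ < 1) :
    DifferentiableAt ℝ (fun r => P22 r w) ρ ∧
    DifferentiableAt ℝ (deriv (fun r => P22 r w)) ρ ∧
    deriv (deriv (fun r => P22 r w)) ρ =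
      (1 / (2 * Real.pi)) * (ρ / (1 - ρ ^ 2) ^ ((3:ℝ) / 2))
      - (1 / (2 * Real.pi)) * (2 * ρ / (1 - ρ ^ 2) ^ ((3:ℝ) / 2)) *
          Real.exp (-w ^ 2 / (2 * (1 - ρ ^ 2))) * (1 - w ^ 2 / (1 - ρ ^ 2))
      + (1 / (2 * Real.pi)) * (1 / Real.sqrt (1 - ρ ^ 2)) * Real.exp (-w ^ 2 / (1 + ρ)) *
          (ρ / (1 - ρ ^ 2) + w ^ 2 / (1 + ρ) ^ 2) := by
  have hr : ρ ∈ Set.Ioo (-1:ℝ) 1 := ⟨h1, h2⟩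
  have hs := aux_s hr
  have hq := Real.sqrt_pos.2 hs
  have hev : deriv (fun r => P22 r w) =ᶠ[nhds ρ]
      fun r => f r w w - f r 0 w - f r w 0 + f r 0 0 := by
    filter_upwards [Ioo_mem_nhds h1 h2] with r hr
    exact (P_hasDeriv r w hr).deriv
  have hD := ((((f_hasDeriv_r ρ w w hr).sub (f_hasDeriv_r ρ 0 w hr)).sub
    (f_hasDeriv_r ρ w 0 hr)).add (f_hasDeriv_r ρ 0 0 hr)).congr_of_eventuallyEq hev
  refine ⟨(P_hasDeriv ρ w hr).differentiableAt, hD.differentiableAt, ?_⟩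
  rw [hD.deriv]
  have h32 : (1 - ρ ^ 2) ^ ((3:ℝ) / 2) = (1 - ρ ^ 2) * Real.sqrt (1 - ρ ^ 2) := by
    rw [Real.sqrt_eq_rpow, ← Real.rpow_one_add' hs.le (by norm_num)]
    norm_num
  have hp : 0 < 1 + ρ := by linarith
  have hm : 0 < 1 - ρ := by linarith
  have e1 : -(w ^ 2 - 2 * ρ * w * w + w ^ 2) / (2 * (1 - ρ ^ 2)) = -w ^ 2 / (1 + ρ) := by
    field_simp
    ring
  have e2 : -((0:ℝ) ^ 2 - 2 * ρ * 0 * w + w ^ 2) / (2 * (1 - ρ ^ 2))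
      = -w ^ 2 / (2 * (1 - ρ ^ 2)) := by ring
  have e3 : -(w ^ 2 - 2 * ρ * w * 0 + (0:ℝ) ^ 2) / (2 * (1 - ρ ^ 2))
      = -w ^ 2 / (2 * (1 - ρ ^ 2)) := by ring
  have e4 : -((0:ℝ) ^ 2 - 2 * ρ * 0 * 0 + (0:ℝ) ^ 2) / (2 * (1 - ρ ^ 2)) = 0 := by simp
  unfold fr f
  rw [e1, e2, e3, e4, h32, Real.exp_zero]
  have e5 : (w - ρ * w) * (w - ρ * w) / (1 - ρ ^ 2) ^ 2 = w ^ 2 / (1 + ρ) ^ 2 := by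
    have : (1 - ρ ^ 2) = (1 - ρ) * (1 + ρ) := by ring
    rw [this]
    field_simp
  rw [e5]
  generalize Real.exp (-w ^ 2 / (1 + ρ)) = A
  generalize Real.exp (-w ^ 2 / (2 * (1 - ρ ^ 2))) = B
  generalize Real.sqrt (1 - ρ ^ 2) = q at *
  field_simp
  ring
end

section
/- For every w > 0 and every ρ with −1 < ρ < 1, the function ρ ↦ P₂₃(ρ,w) is twice differentiable at ρ, and its second derivative equals (1/(2π))·(ρ/(1−ρ²)^{3/2})·exp(−w²/(2(1−ρ²)))·[1 − w²/(1−ρ²)] − (1/(2π))·(1/√(1−ρ²))·exp(−w²/(1+ρ))·[ρ/(1−ρ²) + w²/(1+ρ)²]. -/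
open MeasureTheory Real

noncomputable def P23 (ρ w : ℝ) : ℝ := ∫ x in (0:ℝ)..w, ∫ y in Set.Ioi w, f ρ x y


noncomputable def auxQ (u : ℝ) : ℝ := ∫ t in Set.Ioi u, Real.exp (-t ^ 2 / 2)

lemma auxInt : Integrable (fun t : ℝ => Real.exp (-t ^ 2 / 2)) := by
  have := integrable_exp_neg_mul_sq (b := 1/2) (by norm_num)
  refine this.congr (Filter.Eventually.of_forall fun t => ?_)
  simp only
  congr 1
  ring

lemma auxQ_deriv (u : ℝ) : HasDerivAt auxQ (-Real.exp (-u ^ 2 / 2)) u := by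
  have hc : Continuous (fun t : ℝ => Real.exp (-t ^ 2 / 2)) := by fun_prop
  have h : auxQ = fun v => auxQ 0 - ∫ t in (0:ℝ)..v, Real.exp (-t ^ 2 / 2) := by
    funext v
    have := intervalIntegral.integral_interval_add_Ioi (a := 0) (b := v) auxInt.integrableOn
      auxInt.integrableOn
    simp only [auxQ]
    linarith
  rw [h]
  have := (hc.integral_hasStrictDerivAt 0 u).hasDerivAt.const_sub (auxQ 0)
  exact this

lemma aux_shift (g : ℝ → ℝ) (a c : ℝ) :
    ∫ y in Set.Ioi a, g (y - c) = ∫ y in Set.Ioi (a - c), g y := by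
  rw [← integral_indicator measurableSet_Ioi, ← integral_indicator measurableSet_Ioi,
    ← integral_sub_right_eq_self ((Set.Ioi (a - c)).indicator fun y => g y) c]
  congr 1
  funext y
  simp [Set.indicator]

lemma aux_inner (w r x : ℝ) (h : 0 < 1 - r ^ 2) :
    ∫ y in Set.Ioi w, f r x y =
      (1 / (2 * π)) * Real.exp (-x ^ 2 / 2) * auxQ ((w - r * x) / √(1 - r ^ 2)) := by
  have hs : 0 < √(1 - r ^ 2) := Real.sqrt_pos.2 h
  have hs2 : √(1 - r ^ 2) ^ 2 = 1 - r ^ 2 := Real.sq_sqrt h.le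
  have e : ∀ y, f r x y = (1 / (2 * π * √(1 - r ^ 2)) * Real.exp (-x ^ 2 / 2)) *
      (fun z => (fun t => Real.exp (-t ^ 2 / 2)) ((√(1 - r ^ 2))⁻¹ * z)) (y - r * x) := by
    intro y
    simp only [f]
    rw [mul_assoc (1 / (2 * π * √(1 - r ^ 2))), ← Real.exp_add]
    congr 2
    rw [mul_pow, inv_pow, hs2]
    field_simp
    ring
  simp_rw [e]
  rw [integral_const_mul, aux_shift (fun z => (fun t => Real.exp (-t ^ 2 / 2)) ((√(1 - r ^ 2))⁻¹ * z)),
    integral_comp_mul_left_Ioi (fun t => Real.exp (-t ^ 2 / 2)) _ (inv_pos.2 hs)]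
  rw [show (w - r * x) / √(1 - r ^ 2) = (√(1 - r ^ 2))⁻¹ * (w - r * x) by ring]
  simp only [auxQ, smul_eq_mul, inv_inv]
  field_simp

lemma aux_pos {r : ℝ} (h1 : -1 < r) (h2 : r < 1) : 0 < 1 - r ^ 2 := by nlinarith

lemma aux_sqrt_deriv (r : ℝ) (h : 0 < 1 - r ^ 2) :
    HasDerivAt (fun r : ℝ => √(1 - r ^ 2)) (-r / √(1 - r ^ 2)) r := by
  have h0 : HasDerivAt (fun r : ℝ => 1 - r ^ 2) (-(2 * r)) r := by
    simpa using (hasDerivAt_pow 2 r).const_sub 1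
  convert h0.sqrt h.ne' using 1
  have hs : 0 < √(1 - r ^ 2) := Real.sqrt_pos.2 h
  field_simp

lemma aux_G_deriv (w r x : ℝ) (h : 0 < 1 - r ^ 2) :
    HasDerivAt (fun r => (1 / (2 * π)) * Real.exp (-x ^ 2 / 2) * auxQ ((w - r * x) / √(1 - r ^ 2)))
      (f r x w * ((x - r * w) / (1 - r ^ 2))) r := by
  have hs : 0 < √(1 - r ^ 2) := Real.sqrt_pos.2 h
  have hs2 : √(1 - r ^ 2) ^ 2 = 1 - r ^ 2 := Real.sq_sqrt h.le
  have hu : HasDerivAt (fun r => w - r * x) (-x) r := by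
    simpa using ((hasDerivAt_id r).mul_const x).const_sub w
  have hq := ((auxQ_deriv ((w - r * x) / √(1 - r ^ 2))).comp r
    (hu.div (aux_sqrt_deriv r h) hs.ne')).const_mul ((1 / (2 * π)) * Real.exp (-x ^ 2 / 2))
  refine HasDerivAt.congr_deriv hq ?_
  symm
  have e : f r x w = (1 / (2 * π * √(1 - r ^ 2))) * (Real.exp (-x ^ 2 / 2) *
      Real.exp (-((w - r * x) / √(1 - r ^ 2)) ^ 2 / 2)) := by
    simp only [f]
    rw [← Real.exp_add]
    congr 2
    rw [div_pow, hs2]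
    field_simp
    ring
  rw [e]
  generalize Real.exp (-((w - r * x) / √(1 - r ^ 2)) ^ 2 / 2) = E
  rw [← hs2]
  have hr : r ^ 2 = 1 - √(1 - r ^ 2) ^ 2 := by linarith
  simp only [Real.sqrt_sq hs.le]
  generalize √(1 - r ^ 2) = s at *
  field_simp
  linear_combination (-E * x) * hr

lemma aux_fx_deriv (w r x : ℝ) (h : 0 < 1 - r ^ 2) :
    HasDerivAt (fun x => - f r x w) (f r x w * ((x - r * w) / (1 - r ^ 2))) x := by
  have h0 : HasDerivAt (fun x : ℝ => -(x ^ 2 - 2 * r * x * w + w ^ 2) / (2 * (1 - r ^ 2)))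
      (-(2 * x - 2 * r * w) / (2 * (1 - r ^ 2))) x := by
    have a := hasDerivAt_pow 2 x
    have b := ((hasDerivAt_id x).const_mul (2 * r)).mul_const w
    simpa using (((a.sub b).add_const (w ^ 2)).neg).div_const (2 * (1 - r ^ 2))
  have h3 := (h0.exp.const_mul (1 / (2 * π * √(1 - r ^ 2)))).neg
  refine HasDerivAt.congr_deriv h3 ?_
  symm
  simp only [f]
  field_simp

lemma aux_P23_deriv (w : ℝ) (r : ℝ) (h1 : -1 < r) (h2 : r < 1) :
    HasDerivAt (fun r => P23 r w) (f r 0 w - f r w w) r := by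
  obtain ⟨δ, hδ, hsub⟩ : ∃ δ > 0, Metric.closedBall r δ ⊆ Set.Ioo (-1) 1 :=
    Metric.nhds_basis_closedBall.mem_iff.1 (Ioo_mem_nhds h1 h2)
  have hpos : ∀ ρ ∈ Metric.closedBall r δ, 0 < 1 - ρ ^ 2 := fun ρ hρ =>
    aux_pos (hsub hρ).1 (hsub hρ).2
  have hr := aux_pos h1 h2
  have hcont : ContinuousOn (fun p : ℝ × ℝ => f p.1 p.2 w * ((p.2 - p.1 * w) / (1 - p.1 ^ 2)))
      (Metric.closedBall r δ ×ˢ Set.uIcc 0 w) := by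
    intro p hp
    have hp1 := hpos p.1 hp.1
    have hs : 0 < √(1 - p.1 ^ 2) := Real.sqrt_pos.2 hp1
    apply ContinuousAt.continuousWithinAt
    unfold f
    have : 2 * π * √(1 - p.1 ^ 2) ≠ 0 := by positivity
    have : 1 - p.1 ^ 2 ≠ 0 := hp1.ne'
    have : 2 * (1 - p.1 ^ 2) ≠ 0 := by positivity
    fun_prop (disch := assumption)
  obtain ⟨C, hC⟩ := ((isCompact_closedBall r δ).prod isCompact_uIcc).exists_bound_of_continuousOn hcont
  have hQ : Continuous auxQ := continuous_iff_continuousAt.2 fun u => (auxQ_deriv u).continuousAt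
  have hGc : ∀ ρ, Continuous (fun x => (1 / (2 * π)) * Real.exp (-x ^ 2 / 2) *
      auxQ ((w - ρ * x) / √(1 - ρ ^ 2))) := by
    intro ρ
    fun_prop
  have hF'c : Continuous (fun x => f r x w * ((x - r * w) / (1 - r ^ 2))) := by
    unfold f
    fun_prop
  have key := (intervalIntegral.hasDerivAt_integral_of_dominated_loc_of_deriv_le
    (μ := volume) (a := 0) (b := w) (x₀ := r) (bound := fun _ => C)
    (F := fun ρ x => (1 / (2 * π)) * Real.exp (-x ^ 2 / 2) * auxQ ((w - ρ * x) / √(1 - ρ ^ 2)))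
    (F' := fun ρ x => f ρ x w * ((x - ρ * w) / (1 - ρ ^ 2)))
    (Metric.closedBall_mem_nhds r hδ)
    (Filter.Eventually.of_forall fun ρ => (hGc ρ).aestronglyMeasurable)
    ((hGc r).intervalIntegrable _ _) hF'c.aestronglyMeasurable
    (Filter.Eventually.of_forall fun x hx ρ hρ => hC (ρ, x) ⟨hρ, Set.uIoc_subset_uIcc hx⟩)
    (by simp)
    (Filter.Eventually.of_forall fun x _ ρ hρ => aux_G_deriv w ρ x (hpos ρ hρ))).2
  have hval := intervalIntegral.integral_eq_sub_of_hasDerivAt (a := 0) (b := w)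
    (fun x _ => aux_fx_deriv w r x hr) (hF'c.intervalIntegrable _ _)
  rw [hval] at key
  rw [show f r 0 w - f r w w = -f r w w - -f r 0 w by ring]
  refine key.congr_of_eventuallyEq ?_
  filter_upwards [Metric.closedBall_mem_nhds r hδ] with ρ hρ
  simp only [P23]
  exact intervalIntegral.integral_congr fun x _ => aux_inner w ρ x (hpos ρ hρ)

lemma aux_f0 (w r : ℝ) (h : 0 < 1 - r ^ 2) :
    HasDerivAt (fun r => f r 0 w) ((1 / (2 * π)) * (r / √(1 - r ^ 2) ^ 3) *
          Real.exp (-w ^ 2 / (2 * (1 - r ^ 2))) * (1 - w ^ 2 / (1 - r ^ 2))) r := by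
  have hs : 0 < √(1 - r ^ 2) := Real.sqrt_pos.2 h
  have hs2 : √(1 - r ^ 2) ^ 2 = 1 - r ^ 2 := Real.sq_sqrt h.le
  have hd : HasDerivAt (fun r : ℝ => 2 * (1 - r ^ 2)) (2 * (-(2 * r))) r := by
    simpa using ((hasDerivAt_pow 2 r).const_sub 1).const_mul 2
  have he := ((hasDerivAt_const r (-w ^ 2)).div hd (by positivity)).exp
  have hi := ((aux_sqrt_deriv r h).inv hs.ne').const_mul (1 / (2 * π))
  have := hi.mul he
  have h3 : HasDerivAt (fun r => (1 / (2 * π) * (√(1 - r ^ 2))⁻¹) * Real.exp (-w ^ 2 / (2 * (1 - r ^ 2))))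
      ((1 / (2 * π)) * (r / √(1 - r ^ 2) ^ 3) *
          Real.exp (-w ^ 2 / (2 * (1 - r ^ 2))) * (1 - w ^ 2 / (1 - r ^ 2))) r := by
    refine HasDerivAt.congr_deriv this ?_
    symm
    simp only [Pi.div_apply, Pi.inv_apply]
    generalize Real.exp (-w ^ 2 / (2 * (1 - r ^ 2))) = E
    rw [← hs2]
    simp only [Real.sqrt_sq hs.le]
    generalize √(1 - r ^ 2) = s at *
    field_simp
    ring
  have e : (fun r => f r 0 w) = (fun r => (1 / (2 * π) * (√(1 - r ^ 2))⁻¹) * Real.exp (-w ^ 2 / (2 * (1 - r ^ 2)))) := by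
    funext ρ
    simp only [f]
    rw [show -((0:ℝ) ^ 2 - 2 * ρ * 0 * w + w ^ 2) = -w ^ 2 by ring]
    ring
  rw [e]
  exact h3

lemma aux_fw (w r : ℝ) (h1 : -1 < r) (h2 : r < 1) :
    HasDerivAt (fun r => f r w w) ((1 / (2 * π)) * (1 / √(1 - r ^ 2)) * Real.exp (-w ^ 2 / (1 + r)) *
          (r / (1 - r ^ 2) + w ^ 2 / (1 + r) ^ 2)) r := by
  have h := aux_pos h1 h2
  have hs : 0 < √(1 - r ^ 2) := Real.sqrt_pos.2 h
  have hs2 : √(1 - r ^ 2) ^ 2 = 1 - r ^ 2 := Real.sq_sqrt h.le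
  have hp : 0 < 1 + r := by linarith
  have hd : HasDerivAt (fun r : ℝ => 1 + r) 1 r := by
    simpa using (hasDerivAt_id r).const_add 1
  have he := ((hasDerivAt_const r (-w ^ 2)).div hd hp.ne').exp
  have hi := ((aux_sqrt_deriv r h).inv hs.ne').const_mul (1 / (2 * π))
  have := hi.mul he
  have h3 : HasDerivAt (fun r => (1 / (2 * π) * (√(1 - r ^ 2))⁻¹) * Real.exp (-w ^ 2 / (1 + r)))
      ((1 / (2 * π)) * (1 / √(1 - r ^ 2)) * Real.exp (-w ^ 2 / (1 + r)) *
          (r / (1 - r ^ 2) + w ^ 2 / (1 + r) ^ 2)) r := by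
    refine HasDerivAt.congr_deriv this ?_
    symm
    simp only [Pi.div_apply, Pi.inv_apply]
    generalize Real.exp (-w ^ 2 / (1 + r)) = E
    rw [← hs2]
    simp only [Real.sqrt_sq hs.le]
    generalize √(1 - r ^ 2) = s at *
    field_simp
    ring
  refine h3.congr_of_eventuallyEq ?_
  filter_upwards [Ioo_mem_nhds h1 h2] with ρ hρ
  have g := aux_pos hρ.1 hρ.2
  have g1 : 1 + ρ ≠ 0 := by linarith [hρ.1]
  have g2 : 1 - ρ ≠ 0 := by linarith [hρ.2]
  simp only [f]
  rw [show -(w ^ 2 - 2 * ρ * w * w + w ^ 2) / (2 * (1 - ρ ^ 2)) = -w ^ 2 / (1 + ρ) by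
    rw [show 1 - ρ ^ 2 = (1 - ρ) * (1 + ρ) by ring]
    field_simp
    ring]
  ring

theorem stmt11 (w : ℝ) (hw : 0 < w) (ρ : ℝ) (h1 : -1 < ρ) (h2 : ρ < 1) :
    DifferentiableAt ℝ (fun r => P23 r w) ρ ∧
    DifferentiableAt ℝ (deriv (fun r => P23 r w)) ρ ∧
    deriv (deriv (fun r => P23 r w)) ρ =
      (1 / (2 * Real.pi)) * (ρ / (1 - ρ ^ 2) ^ ((3:ℝ) / 2)) *
          Real.exp (-w ^ 2 / (2 * (1 - ρ ^ 2))) * (1 - w ^ 2 / (1 - ρ ^ 2))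
      - (1 / (2 * Real.pi)) * (1 / Real.sqrt (1 - ρ ^ 2)) * Real.exp (-w ^ 2 / (1 + ρ)) *
          (ρ / (1 - ρ ^ 2) + w ^ 2 / (1 + ρ) ^ 2) := by
  have h := aux_pos h1 h2
  have e : deriv (fun r => P23 r w) =ᶠ[nhds ρ] fun r => f r 0 w - f r w w := by
    filter_upwards [Ioo_mem_nhds h1 h2] with r hr
    exact (aux_P23_deriv w r hr.1 hr.2).deriv
  have d := ((aux_f0 w ρ h).sub (aux_fw w ρ h1 h2)).congr_of_eventuallyEq e
  refine ⟨(aux_P23_deriv w ρ h1 h2).differentiableAt, d.differentiableAt, ?_⟩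
  rw [d.deriv, Real.sqrt_eq_rpow, ← Real.rpow_natCast, ← Real.rpow_mul h.le]
  norm_num
end

section
/- (Fisher information of the 2-bit MLE.) Fix w > 0, k > 0, and ρ with −1 < ρ < 1, and write P₂₂' , P₂₃' , P₃₃' and P₂₂'' , P₂₃'' , P₃₃'' for the first and second derivatives in ρ of P₂₂, P₂₃, P₃₃. Define A(ρ,w) = P₂₂'(ρ,w)²/P₂₂(ρ,w) + 2·P₂₃'(ρ,w)²/P₂₃(ρ,w) + P₃₃'(ρ,w)²/P₃₃(ρ,w) + P₂₂'(−ρ,w)²/P₂₂(−ρ,w) + 2·P₂₃'(−ρ,w)²/P₂₃(−ρ,w) + P₃₃'(−ρ,w)²/P₃₃(−ρ,w). Then the expected negative second derivative of the 2-bit log-likelihood, obtained by replacing each cell count by its expectation (E[k₂₂+k₁₁] = 2k·P₂₂(ρ,w), E[k₂₃+k₃₂+k₀₁+k₁₀] = 4k·P₂₃(ρ,w), E[k₃₃+k₀₀] = 2k·P₃₃(ρ,w), E[k₁₂+k₂₁] = 2k·P₂₂(−ρ,w), E[k₀₂+k₁₃+k₂₀+k₃₁] = 4k·P₂₃(−ρ,w),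 E[k₀₃+k₃₀] = 2k·P₃₃(−ρ,w)), satisfies: −[ 2k·P₂₂(ρ,w)·(P₂₂''(ρ,w)·P₂₂(ρ,w) − P₂₂'(ρ,w)²)/P₂₂(ρ,w)² + 4k·P₂₃(ρ,w)·(P₂₃''(ρ,w)·P₂₃(ρ,w) − P₂₃'(ρ,w)²)/P₂₃(ρ,w)² + 2k·P₃₃(ρ,w)·(P₃₃''(ρ,w)·P₃₃(ρ,w) − P₃₃'(ρ,w)²)/P₃₃(ρ,w)² + 2k·P₂₂(−ρ,w)·(P₂₂''(−ρ,w)·P₂₂(−ρ,w) − P₂₂'(−ρ,w)²)/P₂₂(−ρ,w)² + 4k·P₂₃(−ρ,w)·(P₂₃''(−ρ,w)·P₂₃(−ρ,w) − P₂₃'(−ρ,w)²)/P₂₃(−ρ,w)² + 2k·P₃₃(−ρ,w)·(P₃₃''(−ρ,w)·P₃₃(−ρ,w) − P₃₃'(−ρ,w)²)/P₃₃(−ρ,w)² ] = 2k·A(ρ,w). -/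
open MeasureTheory Real

noncomputable def dP22 (ρ w : ℝ) : ℝ := deriv (fun r => P22 r w) ρ
noncomputable def dP23 (ρ w : ℝ) : ℝ := deriv (fun r => P23 r w) ρ
noncomputable def dP33 (ρ w : ℝ) : ℝ := deriv (fun r => P33 r w) ρ

noncomputable def ddP22 (ρ w : ℝ) : ℝ := deriv (fun r => dP22 r w) ρ
noncomputable def ddP23 (ρ w : ℝ) : ℝ := deriv (fun r => dP23 r w) ρ
noncomputable def ddP33 (ρ w : ℝ) : ℝ := deriv (fun r => dP33 r w) ρ

/-- The Fisher information summand `A(ρ,w)`. -/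
noncomputable def A (ρ w : ℝ) : ℝ :=
  (dP22 ρ w) ^ 2 / P22 ρ w + 2 * (dP23 ρ w) ^ 2 / P23 ρ w + (dP33 ρ w) ^ 2 / P33 ρ w +
  (dP22 (-ρ) w) ^ 2 / P22 (-ρ) w + 2 * (dP23 (-ρ) w) ^ 2 / P23 (-ρ) w +
  (dP33 (-ρ) w) ^ 2 / P33 (-ρ) w


lemma phi_cont : Continuous stdPhi := by unfold stdPhi; fun_prop

lemma phi_pos (x : ℝ) : 0 < stdPhi x := by unfold stdPhi; positivity

lemma phi_le (x : ℝ) : stdPhi x ≤ 1 := by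
  unfold stdPhi
  have h1 : 1 / Real.sqrt (2 * Real.pi) ≤ 1 := by
    rw [div_le_one (by positivity)]
    rw [Real.one_le_sqrt]
    nlinarith [Real.pi_gt_three]
  have h2 : Real.exp (-x ^ 2 / 2) ≤ 1 := by
    rw [Real.exp_le_one_iff]; nlinarith [sq_nonneg x]
  exact mul_le_one₀ h1 (Real.exp_pos _).le h2

lemma phi_int : Integrable stdPhi := by
  have := (integrable_exp_neg_mul_sq (b := 1/2) (by norm_num)).const_mul (1 / Real.sqrt (2 * Real.pi))
  refine this.congr (Filter.Eventually.of_forall fun x => ?_)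
  simp only [stdPhi]; congr 2; ring

lemma xphi_int : Integrable (fun x => |x| * stdPhi x) := by
  have := ((integrable_mul_exp_neg_mul_sq (b := 1/2) (by norm_num)).abs).const_mul (1 / Real.sqrt (2 * Real.pi))
  refine this.congr (Filter.Eventually.of_forall fun x => ?_)
  simp only [stdPhi, abs_mul, abs_of_pos (Real.exp_pos _)]
  rw [mul_left_comm]; congr 3; ring_nf

lemma phi_tendsto : Filter.Tendsto stdPhi Filter.atTop (nhds 0) := by
  have h : Filter.Tendsto (fun x : ℝ => -x^2/2) Filter.atTop Filter.atBot := by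
    have : Filter.Tendsto (fun x : ℝ => x^2/2) Filter.atTop Filter.atTop :=
      (Filter.tendsto_pow_atTop (by norm_num)).atTop_div_const (by norm_num)
    exact (Filter.tendsto_neg_atTop_atBot.comp this).congr fun x => by simp; ring
  have := (Real.tendsto_exp_atBot.comp h).const_mul (1 / Real.sqrt (2 * Real.pi))
  rw [mul_zero] at this
  exact this

lemma phi_deriv (x : ℝ) : HasDerivAt stdPhi (-x * stdPhi x) x := by
  have h : HasDerivAt (fun x : ℝ => -x^2/2) (-x) x := by
    have := ((hasDerivAt_pow 2 x).neg).div_const 2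
    refine this.congr_deriv ?_; push_cast; ring
  have := h.exp.const_mul (1 / Real.sqrt (2 * Real.pi))
  refine HasDerivAt.congr_deriv this ?_; simp only [stdPhi]; ring

noncomputable def tailG (u : ℝ) : ℝ := ∫ t in Set.Ioi u, stdPhi t

lemma tailG_eq (u : ℝ) : tailG u = tailG 0 - ∫ t in (0:ℝ)..u, stdPhi t := by
  have := intervalIntegral.integral_Ioi_sub_Ioi' (μ := volume) (f := stdPhi) (a := 0) (b := u) phi_int.integrableOn phi_int.integrableOn
  unfold tailG; linarith

lemma tailG_deriv (u : ℝ) : HasDerivAt tailG (-stdPhi u) u := by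
  have : tailG = fun u => tailG 0 - ∫ t in (0:ℝ)..u, stdPhi t := funext tailG_eq
  rw [this]
  have h := (phi_cont.integral_hasStrictDerivAt 0 u).hasDerivAt.const_sub (tailG 0)
  exact h

lemma tailG_cont : Continuous tailG :=
  continuous_iff_continuousAt.2 fun u => (tailG_deriv u).continuousAt

lemma tailG_anti : StrictAnti tailG :=
  strictAnti_of_deriv_neg fun u => by rw [(tailG_deriv u).deriv]; linarith [phi_pos u]

lemma tailG_nonneg (u : ℝ) : 0 ≤ tailG u := integral_nonneg fun x => (phi_pos x).le

lemma tailG_pos (u : ℝ) : 0 < tailG u :=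
  (tailG_nonneg (u+1)).trans_lt (tailG_anti (by linarith))

lemma tailG_le (u : ℝ) : tailG u ≤ ∫ t, stdPhi t :=
  setIntegral_le_integral phi_int (Filter.Eventually.of_forall fun x => (phi_pos x).le)

lemma tailG_tendsto : Filter.Tendsto tailG Filter.atTop (nhds 0) := by
  have h := intervalIntegral_tendsto_integral_Ioi (μ := volume) (f := stdPhi) 0 phi_int.integrableOn Filter.tendsto_id
  have := h.const_sub (tailG 0)
  rw [show tailG 0 - ∫ x in Set.Ioi (0:ℝ), stdPhi x = 0 by simp [tailG]] at this
  exact this.congr fun u => (tailG_eq u).symm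

lemma s_pos {ρ : ℝ} (h1 : -1 < ρ) (h2 : ρ < 1) : 0 < 1 - ρ^2 := by nlinarith

lemma f_eq {ρ : ℝ} (h1 : -1 < ρ) (h2 : ρ < 1) (x y : ℝ) :
    f ρ x y = stdPhi x * stdPhi ((y - ρ * x) / √(1 - ρ^2)) / √(1 - ρ^2) := by
  have h := s_pos h1 h2
  have hs : 0 < √(1 - ρ^2) := Real.sqrt_pos.2 h
  have hp : √(2 * π) * √(2 * π) = 2 * π := Real.mul_self_sqrt (by positivity)
  have e : Real.exp (-(x ^ 2 - 2 * ρ * x * y + y ^ 2) / (2 * (1 - ρ ^ 2)))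
      = Real.exp (-x^2/2) * Real.exp (-((y - ρ * x) / √(1 - ρ^2))^2/2) := by
    rw [← Real.exp_add, div_pow, Real.sq_sqrt h.le]
    congr 1; field_simp; ring
  unfold f stdPhi
  rw [e]
  calc _ = 1 / (√(2 * π) * √(2 * π) * √(1 - ρ ^ 2)) * (Real.exp (-x^2/2) * Real.exp (-((y - ρ * x) / √(1 - ρ^2))^2/2)) := by rw [hp]
    _ = _ := by field_simp

lemma f_symm (ρ x y : ℝ) : f ρ x y = f ρ y x := by
  unfold f; congr 3; ring

lemma f_deriv_y {ρ : ℝ} (h1 : -1 < ρ) (h2 : ρ < 1) (x y : ℝ) :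
    HasDerivAt (fun y => - (stdPhi x * tailG ((y - ρ * x) / √(1 - ρ^2)))) (f ρ x y) y := by
  rw [f_eq h1 h2]
  have h : HasDerivAt (fun y => (y - ρ * x) / √(1 - ρ^2)) (1 / √(1 - ρ^2)) y :=
    ((hasDerivAt_id y).sub_const _).div_const _
  have := (((tailG_deriv _).comp y h).const_mul (stdPhi x)).neg
  refine HasDerivAt.congr_deriv this ?_; ring

lemma f_cont_y {ρ : ℝ} (x : ℝ) : Continuous (fun y => f ρ x y) := by
  unfold f; fun_prop

noncomputable def Lf (b ρ x : ℝ) : ℝ := stdPhi x * tailG ((b - ρ * x) / √(1 - ρ^2))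

lemma inner_Ioi {ρ : ℝ} (h1 : -1 < ρ) (h2 : ρ < 1) (x b : ℝ) :
    ∫ y in Set.Ioi b, f ρ x y = Lf b ρ x := by
  have h := s_pos h1 h2
  have hs : 0 < √(1 - ρ^2) := Real.sqrt_pos.2 h
  have ht : Filter.Tendsto (fun y => (y - ρ * x) / √(1 - ρ^2)) Filter.atTop Filter.atTop :=
    (Filter.tendsto_atTop_add_const_right _ (-(ρ*x)) Filter.tendsto_id).atTop_div_const hs
  have ht2 := ((tailG_tendsto.comp ht).const_mul (stdPhi x)).neg
  rw [integral_Ioi_of_hasDerivAt_of_nonneg' (fun y _ => f_deriv_y h1 h2 x y) (fun y _ => ?_) ht2]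
  · simp [Lf]
  · unfold f; positivity

lemma inner_int {ρ : ℝ} (h1 : -1 < ρ) (h2 : ρ < 1) (x a b : ℝ) :
    ∫ y in a..b, f ρ x y = Lf a ρ x - Lf b ρ x := by
  rw [intervalIntegral.integral_eq_sub_of_hasDerivAt (fun y _ => f_deriv_y h1 h2 x y)
    ((f_cont_y x).intervalIntegrable _ _)]
  simp [Lf]; ring

lemma Lf_cont (b ρ : ℝ) : Continuous (Lf b ρ) := by
  unfold Lf
  have := phi_cont
  have := tailG_cont
  fun_prop

lemma Lf_int (b ρ : ℝ) : Integrable (Lf b ρ) := by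
  refine (phi_int.mul_const (∫ t, stdPhi t)).mono' (Lf_cont b ρ).aestronglyMeasurable
    (Filter.Eventually.of_forall fun x => ?_)
  rw [Lf, Real.norm_of_nonneg (mul_nonneg (phi_pos x).le (tailG_nonneg _))]
  exact mul_le_mul_of_nonneg_left (tailG_le _) (phi_pos x).le

noncomputable def Qf (a b ρ : ℝ) : ℝ := ∫ x in Set.Ioi a, Lf b ρ x

noncomputable def Ld (b ρ x : ℝ) : ℝ :=
  stdPhi x * stdPhi ((b - ρ * x) / √(1 - ρ^2)) * (x - ρ * b) / √(1 - ρ^2) ^ 3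

lemma Ld_cont (b ρ : ℝ) : Continuous (Ld b ρ) := by
  unfold Ld
  have := phi_cont
  fun_prop

lemma s_deriv {ρ : ℝ} (h1 : -1 < ρ) (h2 : ρ < 1) :
    HasDerivAt (fun r : ℝ => √(1 - r^2)) (-ρ / √(1 - ρ^2)) ρ := by
  have h := s_pos h1 h2
  have hd : HasDerivAt (fun r : ℝ => 1 - r^2) (-(2 * ρ)) ρ := by
    have := (hasDerivAt_pow 2 ρ).const_sub 1
    refine this.congr_deriv ?_; push_cast; ring
  refine (hd.sqrt h.ne').congr_deriv ?_
  field_simp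

lemma Lf_deriv {ρ : ℝ} (h1 : -1 < ρ) (h2 : ρ < 1) (b x : ℝ) :
    HasDerivAt (fun r => Lf b r x) (Ld b ρ x) ρ := by
  have h := s_pos h1 h2
  have hs : 0 < √(1 - ρ^2) := Real.sqrt_pos.2 h
  have hn : HasDerivAt (fun r : ℝ => b - r * x) (-x) ρ := by
    simpa using ((hasDerivAt_id ρ).mul_const x).const_sub b
  have hq := hn.div (s_deriv h1 h2) hs.ne'
  have := ((tailG_deriv _).comp ρ hq).const_mul (stdPhi x)
  refine HasDerivAt.congr_deriv this ?_
  unfold Ld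
  simp only [Pi.div_apply]
  have hsq : √(1 - ρ^2)^2 = 1 - ρ^2 := Real.sq_sqrt h.le
  generalize √(1 - ρ^2) = s at *
  field_simp
  rw [hsq]; ring

lemma f_deriv_x {ρ : ℝ} (h1 : -1 < ρ) (h2 : ρ < 1) (b x : ℝ) :
    HasDerivAt (fun x => - f ρ x b) (Ld b ρ x) x := by
  have h := s_pos h1 h2
  have hs : 0 < √(1 - ρ^2) := Real.sqrt_pos.2 h
  simp_rw [f_eq h1 h2]
  have hn : HasDerivAt (fun x : ℝ => (b - ρ * x) / √(1 - ρ^2)) (-ρ / √(1 - ρ^2)) x := by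
    have := (((hasDerivAt_id x).const_mul ρ).const_sub b).div_const (√(1 - ρ^2))
    simpa using this
  have := (((phi_deriv x).mul ((phi_deriv _).comp x hn)).div_const (√(1 - ρ^2))).neg
  refine HasDerivAt.congr_deriv this ?_
  unfold Ld
  simp only [Function.comp]
  have hsq : √(1 - ρ^2)^2 = 1 - ρ^2 := Real.sq_sqrt h.le
  generalize √(1 - ρ^2) = s at *
  field_simp
  rw [hsq]; ring

lemma Ld_bound {ρ c : ℝ} (h1 : -1 < ρ) (h2 : ρ < 1) (hc : 0 < c) (hcs : c ≤ √(1 - ρ^2)) (b x : ℝ) :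
    ‖Ld b ρ x‖ ≤ (|x| * stdPhi x + |b| * stdPhi x) / c ^ 3 := by
  have hs : 0 < √(1 - ρ^2) := hc.trans_le hcs
  unfold Ld
  rw [Real.norm_eq_abs, abs_div, abs_mul, abs_mul, abs_of_pos (phi_pos _), abs_of_pos (phi_pos _),
    abs_of_pos (pow_pos hs 3)]
  have hb : |x - ρ * b| ≤ |x| + |b| := by
    refine (abs_sub _ _).trans ?_
    rw [abs_mul]
    have : |ρ| ≤ 1 := abs_le.2 ⟨h1.le, h2.le⟩
    nlinarith [abs_nonneg b]
  have hx := phi_pos x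
  have hle := phi_le ((b - ρ * x) / √(1 - ρ^2))
  have hpos := phi_pos ((b - ρ * x) / √(1 - ρ^2))
  have : stdPhi x * stdPhi ((b - ρ * x) / √(1 - ρ^2)) * |x - ρ * b| ≤ |x| * stdPhi x + |b| * stdPhi x := by
    calc _ ≤ stdPhi x * 1 * (|x| + |b|) := by gcongr
      _ = _ := by ring
  gcongr

lemma bound_int (b c : ℝ) : Integrable (fun x => (|x| * stdPhi x + |b| * stdPhi x) / c ^ 3) :=
  (xphi_int.add (phi_int.const_mul _)).div_const _

lemma Ld_integral {ρ : ℝ} (h1 : -1 < ρ) (h2 : ρ < 1) (a b : ℝ) :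
    ∫ x in Set.Ioi a, Ld b ρ x = f ρ a b := by
  have h := s_pos h1 h2
  have hs : 0 < √(1 - ρ^2) := Real.sqrt_pos.2 h
  have hi : Integrable (Ld b ρ) := (bound_int b _).mono' (Ld_cont b ρ).aestronglyMeasurable
    (Filter.Eventually.of_forall fun x => Ld_bound h1 h2 hs le_rfl b x)
  have ht : Filter.Tendsto (fun x => - f ρ x b) Filter.atTop (nhds 0) := by
    have hd : Filter.Tendsto (fun x => stdPhi x / √(1 - ρ^2)) Filter.atTop (nhds 0) := by
      simpa using phi_tendsto.div_const (√(1 - ρ^2))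
    have : Filter.Tendsto (fun x => f ρ x b) Filter.atTop (nhds 0) := by
      refine squeeze_zero (fun x => by unfold f; positivity) (fun x => ?_) hd
      rw [f_eq h1 h2]
      gcongr
      exact mul_le_of_le_one_right (phi_pos x).le (phi_le _)
    simpa using this.neg
  rw [integral_Ioi_of_hasDerivAt_of_tendsto' (fun x _ => f_deriv_x h1 h2 b x) hi.integrableOn ht]
  simp

lemma Qf_deriv {ρ : ℝ} (h1 : -1 < ρ) (h2 : ρ < 1) (a b : ℝ) :
    HasDerivAt (fun r => Qf a b r) (f ρ a b) ρ := by
  have hr : |ρ| < 1 := abs_lt.2 ⟨h1, h2⟩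
  have hr0 := abs_nonneg ρ
  set q : ℝ := (1 + |ρ|) / 2 with hq
  have hq1 : q < 1 := by rw [hq]; linarith
  have hq0 : 0 < q := by rw [hq]; linarith
  have hc : 0 < √(1 - q^2) := Real.sqrt_pos.2 (by nlinarith)
  rw [← Ld_integral h1 h2 a b]
  refine (hasDerivAt_integral_of_dominated_loc_of_deriv_le (μ := volume.restrict (Set.Ioi a))
    (F := fun r x => Lf b r x) (F' := fun r x => Ld b r x)
    (s := Set.Ioo (-q) q) (bound := fun x => (|x| * stdPhi x + |b| * stdPhi x) / (√(1 - q^2)) ^ 3)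
    ?_ ?_ ?_ ?_ ?_ ?_ ?_).2
  · refine Ioo_mem_nhds ?_ ?_ <;> rw [hq] <;> linarith [neg_abs_le ρ, le_abs_self ρ]
  · exact Filter.Eventually.of_forall fun r => (Lf_cont b r).aestronglyMeasurable
  · exact (Lf_int b ρ).integrableOn
  · exact (Ld_cont b ρ).aestronglyMeasurable
  · refine Filter.Eventually.of_forall fun x r hr => ?_
    refine Ld_bound (by linarith [hr.1]) (by linarith [hr.2]) hc (Real.sqrt_le_sqrt ?_) b x
    nlinarith [hr.1, hr.2]
  · exact (bound_int b _).integrableOn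
  · exact Filter.Eventually.of_forall fun x r hr =>
      Lf_deriv (by linarith [hr.1]) (by linarith [hr.2]) b x

lemma int_sub (b ρ w : ℝ) : ∫ x in (0:ℝ)..w, Lf b ρ x = Qf 0 b ρ - Qf w b ρ :=
  (intervalIntegral.integral_Ioi_sub_Ioi' (Lf_int b ρ).integrableOn (Lf_int b ρ).integrableOn).symm

lemma P33_eq {ρ : ℝ} (h1 : -1 < ρ) (h2 : ρ < 1) (w : ℝ) : P33 ρ w = Qf w w ρ := by
  unfold P33 Qf; simp_rw [inner_Ioi h1 h2]

lemma P23_eq {ρ : ℝ} (h1 : -1 < ρ) (h2 : ρ < 1) (w : ℝ) : P23 ρ w = Qf 0 w ρ - Qf w w ρ := by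
  unfold P23; simp_rw [inner_Ioi h1 h2]; exact int_sub _ _ _

lemma P22_eq {ρ : ℝ} (h1 : -1 < ρ) (h2 : ρ < 1) (w : ℝ) :
    P22 ρ w = (Qf 0 0 ρ - Qf w 0 ρ) - (Qf 0 w ρ - Qf w w ρ) := by
  unfold P22; simp_rw [inner_int h1 h2]
  rw [intervalIntegral.integral_sub ((Lf_cont _ _).intervalIntegrable _ _)
    ((Lf_cont _ _).intervalIntegrable _ _), int_sub, int_sub]

lemma Lf_pos (b ρ x : ℝ) : 0 < Lf b ρ x := mul_pos (phi_pos _) (tailG_pos _)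

lemma P33_pos {ρ : ℝ} (h1 : -1 < ρ) (h2 : ρ < 1) (w : ℝ) : 0 < P33 ρ w := by
  rw [P33_eq h1 h2]
  unfold Qf
  rw [integral_pos_iff_support_of_nonneg (fun x => (Lf_pos w ρ x).le) (Lf_int w ρ).integrableOn]
  have : Function.support (fun x => Lf w ρ x) = Set.univ := by
    ext x; simp [(Lf_pos w ρ x).ne']
  rw [this]; simp

lemma P23_pos {ρ w : ℝ} (h1 : -1 < ρ) (h2 : ρ < 1) (hw : 0 < w) : 0 < P23 ρ w := by
  unfold P23; simp_rw [inner_Ioi h1 h2]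
  exact intervalIntegral.intervalIntegral_pos_of_pos ((Lf_cont _ _).intervalIntegrable _ _)
    (fun x => Lf_pos w ρ x) hw

lemma P22_pos {ρ w : ℝ} (h1 : -1 < ρ) (h2 : ρ < 1) (hw : 0 < w) : 0 < P22 ρ w := by
  unfold P22; simp_rw [inner_int h1 h2]
  refine intervalIntegral.intervalIntegral_pos_of_pos
    (((Lf_cont _ _).sub (Lf_cont _ _)).intervalIntegrable _ _) (fun x => ?_) hw
  have hs : 0 < √(1 - ρ^2) := Real.sqrt_pos.2 (s_pos h1 h2)
  have : tailG ((w - ρ * x) / √(1 - ρ^2)) < tailG ((0 - ρ * x) / √(1 - ρ^2)) :=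
    tailG_anti (by gcongr)
  have := mul_lt_mul_of_pos_left this (phi_pos x)
  unfold Lf; linarith

lemma ev {ρ : ℝ} (h1 : -1 < ρ) (h2 : ρ < 1) {g h : ℝ → ℝ}
    (H : ∀ r, -1 < r → r < 1 → g r = h r) : g =ᶠ[nhds ρ] h := by
  filter_upwards [Ioo_mem_nhds h1 h2] with r hr using H r hr.1 hr.2

lemma dP33_eq {ρ : ℝ} (h1 : -1 < ρ) (h2 : ρ < 1) (w : ℝ) : dP33 ρ w = f ρ w w := by
  unfold dP33
  rw [(ev h1 h2 fun r a b => P33_eq a b w).deriv_eq, (Qf_deriv h1 h2 w w).deriv]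

lemma dP23_eq {ρ : ℝ} (h1 : -1 < ρ) (h2 : ρ < 1) (w : ℝ) : dP23 ρ w = f ρ 0 w - f ρ w w := by
  unfold dP23
  rw [(ev h1 h2 fun r a b => P23_eq a b w).deriv_eq]
  exact ((Qf_deriv h1 h2 0 w).sub (Qf_deriv h1 h2 w w)).deriv

lemma dP22_eq {ρ : ℝ} (h1 : -1 < ρ) (h2 : ρ < 1) (w : ℝ) :
    dP22 ρ w = (f ρ 0 0 - f ρ 0 w) - (f ρ 0 w - f ρ w w) := by
  unfold dP22
  rw [(ev h1 h2 fun r a b => P22_eq a b w).deriv_eq]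
  nth_rewrite 1 [f_symm ρ 0 w]
  exact (((Qf_deriv h1 h2 0 0).sub (Qf_deriv h1 h2 w 0)).sub
    ((Qf_deriv h1 h2 0 w).sub (Qf_deriv h1 h2 w w))).deriv

lemma f_diff {ρ : ℝ} (h1 : -1 < ρ) (h2 : ρ < 1) (a b : ℝ) :
    DifferentiableAt ℝ (fun r => f r a b) ρ := by
  have h := s_pos h1 h2
  have hs : 0 < √(1 - ρ^2) := Real.sqrt_pos.2 h
  have h' : 2 * (1 - ρ^2) ≠ 0 := by positivity
  have h'' : 2 * π * √(1 - ρ^2) ≠ 0 := by positivity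
  have hd := (s_deriv h1 h2).differentiableAt
  unfold f
  refine DifferentiableAt.mul ?_ (DifferentiableAt.exp ?_)
  · exact (differentiableAt_const _).div ((differentiableAt_const _).mul hd) h''
  · exact DifferentiableAt.div (by fun_prop) (by fun_prop) h'

lemma dd_sum {ρ : ℝ} (h1 : -1 < ρ) (h2 : ρ < 1) (w : ℝ) :
    ddP22 ρ w + 2 * ddP23 ρ w + ddP33 ρ w = deriv (fun r => f r 0 0) ρ := by
  unfold ddP22 ddP23 ddP33
  have d0 := (f_diff h1 h2 0 0).hasDerivAt
  have d1 := (f_diff h1 h2 0 w).hasDerivAt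
  have d2 := (f_diff h1 h2 w w).hasDerivAt
  rw [(ev h1 h2 fun r a b => dP33_eq a b w).deriv_eq, (ev h1 h2 fun r a b => dP23_eq a b w).deriv_eq,
    (ev h1 h2 fun r a b => dP22_eq a b w).deriv_eq]
  have e1 := (d1.sub d2).deriv
  have e2 := ((d0.sub d1).sub (d1.sub d2)).deriv
  simp only [Pi.sub_def] at e1 e2
  rw [e1, e2]; ring

lemma f00_odd (ρ : ℝ) : deriv (fun r => f r 0 0) (-ρ) = - deriv (fun r => f r 0 0) ρ := by
  have h := deriv_comp_neg (fun r => f r 0 0) ρ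
  have : (fun r => f (-r) 0 0) = fun r => f r 0 0 := by
    funext r; simp [f]
  rw [this] at h
  linarith

lemma term_eq (c k P d dd : ℝ) (hP : 0 < P) :
    c * k * P * (dd * P - d^2) / P^2 = c * k * (dd - d^2 / P) := by
  field_simp

theorem stmt15 (w k ρ : ℝ) (hw : 0 < w) (hk : 0 < k) (h1 : -1 < ρ) (h2 : ρ < 1) :
    -(2 * k * P22 ρ w * (ddP22 ρ w * P22 ρ w - (dP22 ρ w) ^ 2) / (P22 ρ w) ^ 2
      + 4 * k * P23 ρ w * (ddP23 ρ w * P23 ρ w - (dP23 ρ w) ^ 2) / (P23 ρ w) ^ 2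
      + 2 * k * P33 ρ w * (ddP33 ρ w * P33 ρ w - (dP33 ρ w) ^ 2) / (P33 ρ w) ^ 2
      + 2 * k * P22 (-ρ) w * (ddP22 (-ρ) w * P22 (-ρ) w - (dP22 (-ρ) w) ^ 2) / (P22 (-ρ) w) ^ 2
      + 4 * k * P23 (-ρ) w * (ddP23 (-ρ) w * P23 (-ρ) w - (dP23 (-ρ) w) ^ 2) / (P23 (-ρ) w) ^ 2
      + 2 * k * P33 (-ρ) w * (ddP33 (-ρ) w * P33 (-ρ) w - (dP33 (-ρ) w) ^ 2) / (P33 (-ρ) w) ^ 2)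
    = 2 * k * A ρ w := by
  have h1' : -1 < -ρ := by linarith
  have h2' : -ρ < 1 := by linarith
  rw [term_eq _ _ _ _ _ (P22_pos h1 h2 hw), term_eq _ _ _ _ _ (P23_pos h1 h2 hw),
    term_eq _ _ _ _ _ (P33_pos h1 h2 w), term_eq _ _ _ _ _ (P22_pos h1' h2' hw),
    term_eq _ _ _ _ _ (P23_pos h1' h2' hw), term_eq _ _ _ _ _ (P33_pos h1' h2' w)]
  have e1 := dd_sum h1 h2 w
  have e2 := dd_sum h1' h2' w
  rw [f00_odd] at e2
  unfold A
  linear_combination (-2 * k) * e1 + (-2 * k) * e2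
end
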